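/- Let α ∈ ℂ with -1/2 ≤ Re α ≤ 1/2, let k satisfy max(0, Re α) < k < min(1, 1 − Re α), set λ = sin(πα)/π, and let g ∈ E_k. Then f ∈ E_k satisfies the Stieltjes equation f(x) = g(x) + λ ∫₀^∞ f(y)/(x+y) dy for almost every x > 0 if and only if f(x) = g(x) + λ ∫₀^∞ R₁(x,y;α)·g(y) dy for almost every x > 0, where the latter integral is absolutely convergent. -/

import Mathlib

open MeasureTheory Set Asymptotics

noncomputable section

/-- `r₁(x;α)` from Dixon's resolvent kernels. -/
def r1 (α : ℂ) (x : ℝ) : ℂ :=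
  if α = -(1/2 : ℂ) then
    -(2 / (Real.pi : ℂ)) * ((x : ℂ) ^ ((1 : ℂ)/2) * (Real.log x : ℂ)) / (1 - (x : ℂ) ^ 2)
  else
    (1 / Complex.cos ((Real.pi : ℂ) * α)) *
      (((x : ℂ) ^ (-α) - (x : ℂ) ^ (α + 1)) / (1 - (x : ℂ) ^ 2))

def r2 (α : ℂ) (x : ℝ) : ℂ := -(1 / (x : ℂ)) * r1 (-α) x

def r3 (α : ℂ) (x : ℝ) : ℂ := (x : ℂ) ^ 2 * r2 α x

def R1 (α : ℂ) (x y : ℝ) : ℂ := (1 / (y : ℂ)) * r1 α (x / y)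
def R2 (α : ℂ) (x y : ℝ) : ℂ := (1 / (y : ℂ)) * r2 α (x / y)
def R3 (α : ℂ) (x y : ℝ) : ℂ := (1 / (y : ℂ)) * r3 α (x / y)

/-- membership in `E`: integrable on `(0,∞)` with weight `1/(1+x)`. -/
def MemE (f : ℝ → ℂ) : Prop :=
  IntegrableOn (fun x : ℝ => f x / (1 + (x : ℂ))) (Ioi 0)

/-- membership in `E_k`: integrable on `(0,∞)` with weight `x^{k-1}`. -/
def MemEk (k : ℝ) (f : ℝ → ℂ) : Prop :=
  IntegrableOn (fun x : ℝ => (x ^ (k - 1) : ℝ) • f x) (Ioi 0)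

/-- membership in `B_{ε,η}`. -/
def MemB (ε η : ℝ) (f : ℝ → ℂ) : Prop :=
  ContinuousOn f (Ioi 0) ∧
  ∃ M : ℝ, (∀ x : ℝ, 1 < x → x ^ ε * ‖f x‖ ≤ M) ∧ (∀ x : ℝ, 0 < x → x < 1 → x ^ η * ‖f x‖ ≤ M)

/-- the norm of `B_{ε,η}`. -/
def Bnorm (ε η : ℝ) (f : ℝ → ℂ) : ℝ :=
  sSup ((fun x : ℝ => x ^ ε * ‖f x‖) '' Ioi 1) + sSup ((fun x : ℝ => x ^ η * ‖f x‖) '' Ioo 0 1)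

/-- admissible weight pair `(φ₁,φ₂)`. -/
def AdmissiblePair (φ₁ φ₂ : ℝ → ℝ) : Prop :=
  ContinuousOn φ₁ (Ioi 0) ∧ ContinuousOn φ₂ (Ioi 0) ∧
  (∀ y : ℝ, 0 < y → (φ₁ y ∈ Ioo (0:ℝ) 1 ∧ φ₂ y ∈ Ioo (0:ℝ) 1 ∧ φ₁ y + φ₂ y = 1)) ∧
  φ₁ =O[Filter.atTop] (fun y : ℝ => 1 / y) ∧
  (fun y : ℝ => φ₁ y - 1) =O[nhdsWithin 0 (Ioi 0)] (fun y : ℝ => y)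

/-- the combined kernel `R₂₃`. -/
def R23 (φ₁ φ₂ : ℝ → ℝ) (α : ℂ) (x y : ℝ) : ℂ :=
  (φ₁ y : ℂ) * R2 α x y + (φ₂ y : ℂ) * R3 α x y

/-- Multiplicative convolution of `h` and `p` on the half-line. -/
def mulConv (h p : ℝ → ℂ) (x : ℝ) : ℂ :=
  ∫ y in Ioi (0 : ℝ), (1 / (y : ℂ)) * h (x / y) * p y

theorem integrable_mulConv_prod {G P : ℝ → ℂ} (hGm : Measurable G)
    (hG : IntegrableOn G (Ioi 0)) (hP : IntegrableOn P (Ioi 0)) :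
    Integrable (fun q : ℝ × ℝ => (1 / (q.2 : ℂ)) * G (q.1 / q.2) * P q.2)
      ((volume.restrict (Ioi 0)).prod (volume.restrict (Ioi 0))) := by
  have hm : AEStronglyMeasurable (fun q : ℝ × ℝ => (1 / (q.2 : ℂ)) * G (q.1 / q.2) * P q.2)
      ((volume.restrict (Ioi 0)).prod (volume.restrict (Ioi 0))) := by
    refine AEStronglyMeasurable.mul (Measurable.aestronglyMeasurable ?_)
      hP.aestronglyMeasurable.comp_snd
    fun_prop
  rw [integrable_prod_iff' hm]
  constructor
  · filter_upwards [ae_restrict_mem measurableSet_Ioi] with y (hy : 0 < y)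
    have := (integrableOn_Ioi_comp_mul_left_iff G 0 (inv_pos.2 hy)).2 (by simpa using hG)
    refine Integrable.mul_const (Integrable.const_mul ?_ _) _
    refine this.congr_fun (fun x _ => ?_) measurableSet_Ioi
    simp only [div_eq_inv_mul]
  · refine Integrable.congr (hP.norm.const_mul (∫ x in Ioi (0 : ℝ), ‖G x‖)) ?_
    filter_upwards [ae_restrict_mem measurableSet_Ioi] with y (hy : 0 < y)
    have := integral_comp_mul_left_Ioi (fun x => ‖G x‖) 0 (inv_pos.2 hy)
    simp only [mul_zero, inv_inv, smul_eq_mul] at this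
    simp only [norm_mul, integral_mul_const, integral_const_mul, div_eq_inv_mul, this]
    simp only [norm_one, norm_inv, Complex.norm_real, Real.norm_eq_abs, abs_of_pos hy]
    field_simp

theorem MellinConvergent.aestronglyMeasurable {p : ℝ → ℂ} {s : ℂ} (hp : MellinConvergent p s) :
    AEStronglyMeasurable p (volume.restrict (Ioi 0)) := by
  have h : Measurable fun t : ℝ => (t : ℂ) ^ (1 - s) := by fun_prop
  refine (h.aestronglyMeasurable.mul (Integrable.aestronglyMeasurable hp)).congr ?_
  filter_upwards [ae_restrict_mem measurableSet_Ioi] with t (ht : 0 < t)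
  have h0 : (t : ℂ) ≠ 0 := by exact_mod_cast ht.ne'
  simp only [Pi.mul_apply, smul_eq_mul]
  rw [← mul_assoc, ← Complex.cpow_add _ _ h0]
  simp

theorem hasMellin_mulConv {h p : ℝ → ℂ} {s : ℂ} (hm : Measurable h)
    (hh : MellinConvergent h s) (hp : MellinConvergent p s) :
    HasMellin (mulConv h p) s (mellin h s * mellin p s) := by
  have hmG : Measurable fun t : ℝ => (t : ℂ) ^ (s - 1) • h t := by fun_prop
  have key := integrable_mulConv_prod hmG hh hp
  have hE : ∀ x : ℝ, 0 < x → ∫ y in Ioi (0 : ℝ), (1 / (y : ℂ)) *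
      (((x / y : ℝ) : ℂ) ^ (s - 1) • h (x / y)) * ((y : ℂ) ^ (s - 1) • p y) =
      (x : ℂ) ^ (s - 1) • mulConv h p x := by
    intro x hx
    rw [mulConv, ← integral_smul]
    refine setIntegral_congr_fun measurableSet_Ioi fun y (hy : 0 < y) => ?_
    have : (x : ℂ) ^ (s - 1) = ((x / y : ℝ) : ℂ) ^ (s - 1) * (y : ℂ) ^ (s - 1) := by
      rw [← Complex.mul_cpow_ofReal_nonneg (by positivity) hy.le, ← Complex.ofReal_mul,
        div_mul_cancel₀ _ hy.ne']
    simp only [this, smul_eq_mul]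
    ring
  constructor
  · refine IntegrableOn.congr_fun (f := fun x : ℝ => ∫ y in Ioi (0 : ℝ), (1 / (y : ℂ)) *
      (((x / y : ℝ) : ℂ) ^ (s - 1) • h (x / y)) * ((y : ℂ) ^ (s - 1) • p y))
      key.integral_prod_left (fun x hx => hE x hx) measurableSet_Ioi
  · rw [mellin, ← setIntegral_congr_fun measurableSet_Ioi fun x hx => hE x hx]
    rw [integral_integral_swap key, mellin, mellin, ← integral_const_mul]
    refine setIntegral_congr_fun measurableSet_Ioi fun y (hy : 0 < y) => ?_
    have := integral_comp_mul_left_Ioi (fun t : ℝ => (t : ℂ) ^ (s - 1) • h t) 0 (inv_pos.2 hy)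
    simp only [mul_zero, inv_inv] at this
    simp only [integral_mul_const, integral_const_mul, div_eq_inv_mul, this]
    have h0 : (y : ℂ) ≠ 0 := by exact_mod_cast hy.ne'
    simp [h0]

theorem memEk_iff_mellinConvergent {f : ℝ → ℂ} {s : ℂ} :
    MemEk s.re f ↔ MellinConvergent f s := by
  have hm : MemEk s.re f → AEStronglyMeasurable f (volume.restrict (Ioi 0)) := by
    intro h
    have h : MellinConvergent f (s.re : ℂ) := by
      refine IntegrableOn.congr_fun h (fun x (hx : 0 < x) => ?_) measurableSet_Ioi
      simp only [Complex.real_smul, smul_eq_mul]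
      rw [Complex.ofReal_cpow hx.le]
      simp
    exact h.aestronglyMeasurable
  have hn : ∀ hf : AEStronglyMeasurable f (volume.restrict (Ioi 0)),
      MemEk s.re f ↔ MellinConvergent f s := by
    intro hf
    have hf' : AEStronglyMeasurable (fun x : ℝ => (x ^ (s.re - 1) : ℝ) • f x)
        (volume.restrict (Ioi 0)) :=
      have hx : Measurable fun x : ℝ => (x ^ (s.re - 1) : ℝ) := by fun_prop
      hx.aestronglyMeasurable.smul hf
    rw [MellinConvergent, mellin_convergent_iff_norm Subset.rfl measurableSet_Ioi hf, MemEk,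
      IntegrableOn, ← integrable_norm_iff hf', ← IntegrableOn]
    refine integrableOn_congr_fun (fun x (hx : 0 < x) => ?_) measurableSet_Ioi
    rw [norm_smul, Real.norm_of_nonneg (by positivity)]
  exact ⟨fun h => (hn (hm h)).1 h, fun h => (hn h.aestronglyMeasurable).2 h⟩

theorem ae_eq_zero_of_fourier_eq_zero {f : ℝ → ℂ} (hf : Integrable f)
    (h : ∀ t, FourierTransform.fourier f t = 0) : ∀ᵐ x, f x = 0 := by
  refine ae_eq_zero_of_integral_contDiff_smul_eq_zero hf.locallyIntegrable fun φ hφ hφc => ?_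
  have hφ' : ContDiff ℝ (⊤ : ℕ∞) (fun x => (φ x : ℂ)) := Complex.ofRealCLM.contDiff.comp hφ
  have hc' : HasCompactSupport (fun x => (φ x : ℂ)) :=
    hφc.comp_left (g := fun r : ℝ => (r : ℂ)) rfl
  let ψ : SchwartzMap ℝ ℂ := hc'.toSchwartzMap hφ'
  let χ : SchwartzMap ℝ ℂ := FourierTransformInv.fourierInv ψ
  have h1 : FourierTransform.fourier (χ : ℝ → ℂ) = fun x => (φ x : ℂ) := by
    rw [← SchwartzMap.fourier_coe]
    simp only [χ, FourierTransform.fourier_fourierInv_eq]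
    rfl
  have h2 := VectorFourier.integral_fourierIntegral_smul_eq_flip (μ := volume) (ν := volume)
    (L := innerₗ ℝ) (e := Real.fourierChar) (f := (χ : ℝ → ℂ)) (g := f)
    Real.continuous_fourierChar continuous_inner χ.integrable hf
  rw [flip_innerₗ] at h2
  have h3 : ∀ x, VectorFourier.fourierIntegral Real.fourierChar volume (innerₗ ℝ) f x = 0 := h
  have h4 : ∀ x, VectorFourier.fourierIntegral Real.fourierChar volume (innerₗ ℝ) (χ : ℝ → ℂ) x
    = φ x := fun x => congrFun h1 x
  simpa [h3, h4] using h2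

theorem ae_eq_zero_iff_mellin_eq_zero {e : ℝ → ℂ} {k : ℝ} (he : MemEk k e) :
    (∀ᵐ x ∂(volume.restrict (Ioi (0 : ℝ))), e x = 0) ↔ ∀ z : ℂ, z.re = k → mellin e z = 0 := by
  constructor
  · intro h z _
    rw [mellin]
    refine integral_eq_zero_of_ae ?_
    filter_upwards [h] with x hx
    simp [hx]
  · intro h
    have hi : Integrable fun u : ℝ => Real.exp (-k * u) • e (Real.exp (-u)) := by
      have hi : IntegrableOn (fun x : ℝ => (x ^ (k - 1) : ℝ) • e x)
          ((fun u : ℝ => Real.exp (-u)) '' univ) := by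
        rw [image_univ]
        have : range (fun u : ℝ => Real.exp (-u)) = Ioi 0 := by
          rw [← Real.range_exp]
          exact neg_surjective.range_comp Real.exp
        rwa [this]
      rw [integrableOn_image_iff_integrableOn_abs_deriv_smul MeasurableSet.univ
        (f' := fun u => -Real.exp (-u))
        (fun u _ => by simpa using ((hasDerivAt_neg u).exp).hasDerivWithinAt (s := univ))
        (fun a _ b _ hab => by simpa using hab), integrableOn_univ] at hi
      refine hi.congr (Filter.Eventually.of_forall fun u => ?_)
      simp only [abs_neg, Real.abs_exp, smul_smul]
      rw [← Real.exp_mul, ← Real.exp_add]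
      ring_nf
    have hz := ae_eq_zero_of_fourier_eq_zero hi fun t => by
      have := h (k + (2 * Real.pi * t : ℝ) * Complex.I) (by simp)
      rw [mellin_eq_fourier] at this
      simpa [Real.pi_ne_zero] using this
    rw [ae_restrict_iff' measurableSet_Ioi, ae_iff]
    refine measure_mono_null (t := (fun u : ℝ => Real.exp (-u)) ''
      {u | ¬ (Real.exp (-k * u) • e (Real.exp (-u)) = 0)}) ?_ ?_
    · intro x hx
      simp only [mem_ofPred_eq, Classical.not_imp, mem_Ioi] at hx
      exact ⟨-Real.log x, by simp [Real.exp_log hx.1, hx.2], by simp [Real.exp_log hx.1]⟩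
    · exact addHaar_image_eq_zero_of_differentiableOn_of_addHaar_eq_zero _
        (by fun_prop) (ae_iff.1 hz)

theorem hasMellin_one_div_one_add {s : ℂ} (h0 : 0 < s.re) (h1 : s.re < 1) :
    HasMellin (fun t : ℝ => 1 / (1 + (t : ℂ))) s
      (Real.pi / Complex.sin (Real.pi * s)) := by
  set h : ℝ → ℂ := fun t => (Real.exp (-t) : ℂ) with hh
  set p : ℝ → ℂ := fun t => (t : ℂ) ^ (-1 : ℂ) • h (t ^ (-1 : ℝ)) with hp
  have hc : ∀ {z : ℂ}, 0 < z.re → HasMellin h z (Complex.Gamma z) := by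
    intro z hz
    refine ⟨(Complex.GammaIntegral_convergent hz).congr_fun (fun t _ => ?_) measurableSet_Ioi, ?_⟩
    · simp only [hh, smul_eq_mul, mul_comm]
    · rw [Complex.Gamma_eq_integral hz, Complex.GammaIntegral_eq_mellin]
  have hs1 : (s + -1) / ((-1 : ℝ) : ℂ) = 1 - s := by push_cast; ring
  have hpc : HasMellin p s (Complex.Gamma (1 - s)) := by
    have h2 := hc (z := 1 - s) (by simpa using h1)
    constructor
    · rw [hp, MellinConvergent.cpow_smul, MellinConvergent.comp_rpow (f := h) (by norm_num), hs1]
      exact h2.1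
    · rw [hp, mellin_cpow_smul, mellin_comp_rpow h, hs1, h2.2]
      simp
  have hm : Measurable h := by fun_prop
  have key := hasMellin_mulConv hm (hc h0).1 hpc.1
  have heq : ∀ x ∈ Ioi (0 : ℝ), mulConv h p x = 1 / (1 + (x : ℂ)) := by
    intro x (hx : 0 < x)
    have hx1 : 0 < 1 + x := by positivity
    have e1 : mulConv h p x =
        mellin (fun t : ℝ => (fun u : ℝ => h ((1 + x) * u)) (t ^ (-1 : ℝ))) (-1) := by
      refine setIntegral_congr_fun measurableSet_Ioi fun y (hy : 0 < y) => ?_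
      have hy0 : (y : ℂ) ≠ 0 := by exact_mod_cast hy.ne'
      have e2 : h ((1 + x) * y ^ (-1 : ℝ)) = h (x / y) * h (y ^ (-1 : ℝ)) := by
        simp only [hh, ← Complex.ofReal_mul, ← Real.exp_add, Real.rpow_neg_one]
        congr 2
        field_simp
        ring
      have e3 : (y : ℂ) ^ (-1 - 1 : ℂ) = 1 / y * (y : ℂ) ^ (-1 : ℂ) := by
        rw [sub_eq_add_neg, Complex.cpow_add _ _ hy0, Complex.cpow_neg_one, one_div]
      simp only [hp, e2, e3, smul_eq_mul]
      ring
    rw [e1, mellin_comp_rpow (fun u : ℝ => h ((1 + x) * u)), mellin_comp_mul_left h _ hx1,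
      (hc (by norm_num)).2]
    norm_num [Complex.cpow_neg_one]
  have hv : Complex.Gamma s * Complex.Gamma (1 - s) = Real.pi / Complex.sin (Real.pi * s) :=
    Complex.Gamma_mul_Gamma_one_sub s
  constructor
  · exact IntegrableOn.congr_fun key.1 (fun x hx => by simp only [heq x hx]) measurableSet_Ioi
  · rw [← hv, ← (hc h0).2, ← hpc.2, ← key.2]
    exact (setIntegral_congr_fun measurableSet_Ioi fun x hx => by simp only [heq x hx]).symm

theorem hasMellin_cpow_div_one_add_sq {a z : ℂ} (h0 : 0 < (z + a).re) (h2 : (z + a).re < 2) :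
    HasMellin (fun t : ℝ => (t : ℂ) ^ a / (1 + (t : ℂ) ^ 2)) z
      (Real.pi / 2 / Complex.sin (Real.pi * (z + a) / 2)) := by
  set f : ℝ → ℂ := fun t => 1 / (1 + (t : ℂ)) with hf
  have hm := hasMellin_one_div_one_add (s := (z + a) / (2 : ℝ))
    (by rw [Complex.div_ofReal_re]; linarith) (by rw [Complex.div_ofReal_re]; linarith)
  have heq : (fun t : ℝ => (t : ℂ) ^ a / (1 + (t : ℂ) ^ 2)) =
      fun t : ℝ => (t : ℂ) ^ a • f (t ^ (2 : ℝ)) := by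
    funext t
    simp [hf, div_eq_mul_inv]
  rw [heq]
  constructor
  · rw [MellinConvergent.cpow_smul, MellinConvergent.comp_rpow (f := f) (by norm_num)]
    exact hm.1
  · rw [mellin_cpow_smul, mellin_comp_rpow f, hm.2]
    simp only [Nat.abs_ofNat, Complex.real_smul, Complex.ofReal_inv, Complex.ofReal_ofNat]
    rw [mul_div_assoc]
    ring

theorem hasMellin_one_div_add {c : ℝ} (hc : 0 < c) {s : ℂ} (h0 : 0 < s.re) (h1 : s.re < 1) :
    HasMellin (fun t : ℝ => 1 / ((c : ℂ) + t)) s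
      ((c : ℂ) ^ (s - 1) * (Real.pi / Complex.sin (Real.pi * s))) := by
  set f : ℝ → ℂ := fun t => 1 / (1 + (t : ℂ)) with hf
  have hm := hasMellin_one_div_one_add h0 h1
  have hc0 : (c : ℂ) ≠ 0 := by exact_mod_cast hc.ne'
  have heq : ∀ t : ℝ, 1 / ((c : ℂ) + t) = (c : ℂ)⁻¹ • f (c⁻¹ * t) := by
    intro t
    have : (c : ℂ) + t = c * (1 + (c : ℂ)⁻¹ * t) := by field_simp
    rw [this]
    simp [hf, mul_comm]
  simp_rw [heq]
  refine ⟨((MellinConvergent.comp_mul_left (inv_pos.2 hc)).2 hm.1).const_smul _, ?_⟩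
  rw [mellin_const_smul, mellin_comp_mul_left f _ (inv_pos.2 hc), hm.2]
  simp only [smul_eq_mul, ← mul_assoc]
  congr 1
  rw [Complex.ofReal_inv, Complex.inv_cpow _ _ (by simp [Complex.arg_ofReal_of_nonneg hc.le,
    Real.pi_ne_zero.symm]), ← Complex.cpow_neg, neg_neg, Complex.cpow_sub _ _ hc0,
    Complex.cpow_one]
  field_simp

theorem differentiableAt_mellin_resolvent_prod {c : ℝ} (hc : 0 < c) {s : ℂ} (h0 : 0 < s.re)
    (h2 : s.re < 2) :
    DifferentiableAt ℂ (mellin fun t : ℝ => 1 / ((1 + (t : ℂ)) * (c + t))) s := by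
  have hne : ∀ t : ℝ, 0 ≤ t → (1 + (t : ℂ)) * (c + t) ≠ 0 := fun t ht => by
    have : (1 + t) * (c + t) ≠ 0 := by positivity
    exact_mod_cast this
  have hcont : ContinuousOn (fun t : ℝ => 1 / ((1 + (t : ℂ)) * (c + t))) (Ici 0) :=
    ContinuousOn.div (by fun_prop) (by fun_prop) fun t ht => hne t ht
  refine mellin_differentiableAt_of_isBigO_rpow (a := 2) (b := 0)
    ((hcont.mono Ioi_subset_Ici_self).locallyIntegrableOn measurableSet_Ioi) ?_ h2 ?_ h0
  · refine IsBigO.of_bound 1 ?_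
    filter_upwards [Filter.eventually_gt_atTop 0] with t ht
    have e : (1 : ℂ) / ((1 + (t : ℂ)) * (c + t)) = ((1 / ((1 + t) * (c + t)) : ℝ) : ℂ) := by
      push_cast; rfl
    rw [e, Complex.norm_real, Real.norm_of_nonneg (by positivity),
      Real.norm_of_nonneg (by positivity), one_mul, Real.rpow_neg ht.le, Real.rpow_two, one_div]
    gcongr
    nlinarith [mul_pos hc ht]
  · have h := ((hcont 0 self_mem_Ici).mono Ioi_subset_Ici_self).isBigO_one ℝ
    simpa using! h

theorem sin_mul_mellin_resolvent_prod {c : ℝ} (hc : 0 < c) (hc1 : c ≠ 1) {s : ℂ} (h0 : 0 < s.re)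
    (h2 : s.re < 2) :
    Complex.sin (Real.pi * s) * mellin (fun t : ℝ => 1 / ((1 + (t : ℂ)) * (c + t))) s =
      Real.pi * ((1 - (c : ℂ) ^ (s - 1)) / (c - 1)) := by
  have hc0 : (c : ℂ) ≠ 0 := by exact_mod_cast hc.ne'
  have hc1' : (c : ℂ) - 1 ≠ 0 := sub_ne_zero.2 (by exact_mod_cast hc1)
  set U : Set ℂ := {z | 0 < z.re} ∩ {z | z.re < 2} with hU
  have hUo : IsOpen U := (isOpen_lt continuous_const Complex.continuous_re).inter
    (isOpen_lt Complex.continuous_re continuous_const)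
  have hUc : Convex ℝ U := (convex_halfSpace_re_gt 0).inter (convex_halfSpace_re_lt 2)
  have hf : AnalyticOnNhd ℂ (fun z : ℂ => Complex.sin (Real.pi * z) *
      mellin (fun t : ℝ => 1 / ((1 + (t : ℂ)) * (c + t))) z) U := by
    refine DifferentiableOn.analyticOnNhd (fun z hz => ?_) hUo
    refine (DifferentiableAt.mul (by fun_prop)
      (differentiableAt_mellin_resolvent_prod hc hz.1 hz.2)).differentiableWithinAt
  have hg : AnalyticOnNhd ℂ (fun z : ℂ => Real.pi * ((1 - (c : ℂ) ^ (z - 1)) / (c - 1))) U := by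
    refine DifferentiableOn.analyticOnNhd (fun z hz => ?_) hUo
    have : DifferentiableAt ℂ (fun z : ℂ => (c : ℂ) ^ (z - 1)) z :=
      DifferentiableAt.const_cpow (by fun_prop) (Or.inl hc0)
    exact ((((differentiableAt_const _).sub this).div_const _).const_mul _).differentiableWithinAt
  have hhalf : (1 / 2 : ℂ) ∈ U := by constructor <;> norm_num
  refine hf.eqOn_of_preconnected_of_eventuallyEq hg hUc.isPreconnected hhalf ?_ ⟨h0, h2⟩
  have hV : {z : ℂ | 0 < z.re} ∩ {z | z.re < 1} ∈ nhds (1 / 2 : ℂ) :=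
    ((isOpen_lt continuous_const Complex.continuous_re).inter
      (isOpen_lt Complex.continuous_re continuous_const)).mem_nhds (by constructor <;> norm_num)
  filter_upwards [hV] with z hz
  have hsin : Complex.sin (Real.pi * z) ≠ 0 := by
    intro h
    have h' := Complex.Gamma_mul_Gamma_one_sub z
    rw [h, div_zero, mul_eq_zero] at h'
    rcases h' with h' | h'
    · exact Complex.Gamma_ne_zero_of_re_pos hz.1 h'
    · exact Complex.Gamma_ne_zero_of_re_pos (by simpa using hz.2) h'
  have m1 := hasMellin_one_div_one_add hz.1 hz.2
  have m2 := hasMellin_one_div_add hc hz.1 hz.2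
  have m3 := (hasMellin_sub m1.1 m2.1).2
  have e : mellin (fun t : ℝ => 1 / ((1 + (t : ℂ)) * (c + t))) z =
      mellin (fun t : ℝ => (1 / (1 + (t : ℂ)) - 1 / ((c : ℂ) + t)) / (c - 1)) z := by
    refine setIntegral_congr_fun measurableSet_Ioi fun t (ht : 0 < t) => ?_
    have a1 : 1 + (t : ℂ) ≠ 0 := by exact_mod_cast (by positivity : 1 + t ≠ 0)
    have a2 : (c : ℂ) + t ≠ 0 := by exact_mod_cast (by positivity : c + t ≠ 0)
    simp only
    congr 1
    field_simp
    ring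
  simp only [e, mellin_div_const, m3, m1.2, m2.2]
  field_simp

theorem mellin_resolvent_prod_one {c : ℝ} (hc : 0 < c) (hc1 : c ≠ 1) :
    mellin (fun t : ℝ => 1 / ((1 + (t : ℂ)) * (c + t))) 1 = Real.log c / (c - 1) := by
  have hc0 : (c : ℂ) ≠ 0 := by exact_mod_cast hc.ne'
  have hpi : (Real.pi : ℂ) ≠ 0 := by exact_mod_cast Real.pi_ne_zero
  have hd := (differentiableAt_mellin_resolvent_prod hc (s := 1) (by simp) (by simp)).hasDerivAt
  have hs : HasDerivAt (fun z : ℂ => Complex.sin (Real.pi * z)) (-Real.pi) 1 := by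
    have := ((hasDerivAt_id (1 : ℂ)).const_mul (Real.pi : ℂ)).csin
    simpa using this
  have hl := hs.mul hd
  have hr : HasDerivAt (fun z : ℂ => Real.pi * ((1 - (c : ℂ) ^ (z - 1)) / (c - 1)))
      (Real.pi * (-(Real.log c) / (c - 1))) 1 := by
    have h1 := ((hasDerivAt_id (1 : ℂ)).sub_const 1).const_cpow (c := (c : ℂ)) (Or.inl hc0)
    have h2 := ((h1.const_sub 1).div_const ((c : ℂ) - 1)).const_mul (Real.pi : ℂ)
    simpa [Complex.ofReal_log hc.le] using h2
  have hV : {z : ℂ | 0 < z.re} ∩ {z | z.re < 2} ∈ nhds (1 : ℂ) :=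
    ((isOpen_lt continuous_const Complex.continuous_re).inter
      (isOpen_lt Complex.continuous_re continuous_const)).mem_nhds (by constructor <;> norm_num)
  have hl' := hl.congr_of_eventuallyEq (f₁ := fun z : ℂ =>
    Real.pi * ((1 - (c : ℂ) ^ (z - 1)) / (c - 1))) (by
      filter_upwards [hV] with z hz
      exact (sin_mul_mellin_resolvent_prod hc hc1 hz.1 hz.2).symm)
  have := hl'.unique hr
  simp only [mul_one, Complex.sin_pi, zero_mul, add_zero] at this
  have h3 : (Real.pi : ℂ) * mellin (fun t : ℝ => 1 / ((1 + (t : ℂ)) * (c + t))) 1 =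
      Real.pi * (Real.log c / (c - 1)) := by
    linear_combination -this
  exact mul_left_cancel₀ hpi h3

theorem sin_pi_mul_ne_zero_of_re_mem {s : ℂ} (h0 : 0 < s.re) (h1 : s.re < 2) (hs : s ≠ 1) :
    Complex.sin (Real.pi * s) ≠ 0 := by
  intro h
  obtain ⟨n, hn⟩ := Complex.sin_eq_zero_iff.1 h
  have hpi : (Real.pi : ℂ) ≠ 0 := by exact_mod_cast Real.pi_ne_zero
  have hsn : s = n := mul_left_cancel₀ hpi (by rw [hn]; ring)
  subst hsn
  simp only [Complex.intCast_re] at h0 h1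
  have a : 0 < n := by exact_mod_cast h0
  have b : n < 2 := by exact_mod_cast h1
  have : n = 1 := by lia
  simp [this] at hs

theorem r1_eq_mulConv {α : ℂ} (hα1 : -(1/2) ≤ α.re) (hα2 : α.re < 1/2) {x : ℝ} (hx : 0 < x)
    (hx1 : x ≠ 1) :
    r1 α x = 2 / Real.pi * mulConv (fun t : ℝ => (t : ℂ) ^ (α + 1) / (1 + (t : ℂ) ^ 2))
      (fun t : ℝ => (t : ℂ) ^ (-α) / (1 + (t : ℂ) ^ 2)) x := by
  have hpi : (Real.pi : ℂ) ≠ 0 := by exact_mod_cast Real.pi_ne_zero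
  have hx0 : (x : ℂ) ≠ 0 := by exact_mod_cast hx.ne'
  set c : ℝ := x ^ 2 with hc
  have hc0 : 0 < c := by positivity
  have hc1 : c ≠ 1 := fun h => hx1 ((pow_eq_one_iff_of_nonneg hx.le two_ne_zero).1 h)
  have hd : (x : ℂ) ^ 2 - 1 ≠ 0 := sub_ne_zero.2 (by exact_mod_cast hc1)
  have hd' : 1 - (x : ℂ) ^ 2 ≠ 0 := sub_ne_zero.2 (by exact_mod_cast hc1.symm)
  set f : ℝ → ℂ := fun t => 1 / ((1 + (t : ℂ)) * (c + t)) with hf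
  have e1 : mulConv (fun t : ℝ => (t : ℂ) ^ (α + 1) / (1 + (t : ℂ) ^ 2))
      (fun t : ℝ => (t : ℂ) ^ (-α) / (1 + (t : ℂ) ^ 2)) x =
      (x : ℂ) ^ (α + 1) * mellin (fun t : ℝ => f (t ^ (2 : ℝ))) (1 - 2 * α) := by
    rw [mellin, ← integral_const_mul]
    refine setIntegral_congr_fun measurableSet_Ioi fun y (hy : 0 < y) => ?_
    have hy0 : (y : ℂ) ≠ 0 := by exact_mod_cast hy.ne'
    have a1 : 1 + (y : ℂ) ^ 2 ≠ 0 := by exact_mod_cast (by positivity : 1 + y ^ 2 ≠ 0)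
    have a2 : (y : ℂ) ^ 2 + (x : ℂ) ^ 2 ≠ 0 := by
      exact_mod_cast (by positivity : y ^ 2 + x ^ 2 ≠ 0)
    have a3 : 1 + ((x : ℂ) / y) ^ 2 ≠ 0 := by
      exact_mod_cast (by positivity : 1 + (x / y) ^ 2 ≠ 0)
    have b1 : ((x / y : ℝ) : ℂ) ^ (α + 1) = (x : ℂ) ^ (α + 1) * (y : ℂ) ^ (-α) / y := by
      rw [Complex.ofReal_div, div_eq_mul_inv, ← Complex.ofReal_inv,
        Complex.mul_cpow_ofReal_nonneg hx.le (by positivity), Complex.ofReal_inv,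
        Complex.inv_cpow _ _ (by simp [Complex.arg_ofReal_of_nonneg hy.le, Real.pi_ne_zero.symm]),
        ← Complex.cpow_neg, neg_add, Complex.cpow_add _ _ hy0, Complex.cpow_neg_one]
      field_simp
    have b2 : (y : ℂ) ^ (1 - 2 * α - 1) = (y : ℂ) ^ (-α) * (y : ℂ) ^ (-α) := by
      rw [← Complex.cpow_add _ _ hy0]
      ring_nf
    simp only [b1, b2, hf, hc, smul_eq_mul, Real.rpow_two]
    push_cast
    rw [add_comm ((x : ℂ) ^ 2)]
    field_simp
  have e2 : mellin (fun t : ℝ => f (t ^ (2 : ℝ))) (1 - 2 * α) = 1 / 2 * mellin f (1 / 2 - α) := by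
    rw [mellin_comp_rpow f]
    simp only [Nat.abs_ofNat, Complex.real_smul, Complex.ofReal_inv, Complex.ofReal_ofNat]
    rw [one_div, show (1 - 2 * α) / 2 = 2⁻¹ - α by ring]
  have hcx : (c : ℂ) = (x : ℂ) ^ 2 := by rw [hc]; push_cast; rfl
  rw [e1, e2, r1]
  split_ifs with h
  · have : (1 / 2 - α : ℂ) = 1 := by rw [h]; norm_num
    rw [this, hf, mellin_resolvent_prod_one hc0 hc1, hcx, hc, Real.log_pow, h]
    have : (-(1 / 2) + 1 : ℂ) = 1 / 2 := by norm_num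
    rw [this]
    push_cast
    field_simp
    ring
  · have hs := sin_mul_mellin_resolvent_prod hc0 hc1 (s := 1 / 2 - α)
      (by norm_num; linarith) (by norm_num; linarith)
    have hne := sin_pi_mul_ne_zero_of_re_mem (s := 1 / 2 - α) (by norm_num; linarith)
      (by norm_num; linarith) (fun h' => h (by linear_combination -h'))
    have hcos : Complex.sin (Real.pi * (1 / 2 - α)) = Complex.cos (Real.pi * α) := by
      rw [← Complex.sin_pi_div_two_sub]
      ring_nf
    rw [hcos] at hs hne
    have hM : mellin f (1 / 2 - α) = Real.pi * ((1 - (c : ℂ) ^ (1 / 2 - α - 1)) / (c - 1)) /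
        Complex.cos (Real.pi * α) := by
      rw [eq_div_iff hne, mul_comm]
      exact hs
    have hp : (c : ℂ) ^ (1 / 2 - α - 1) * (x : ℂ) ^ (α + 1) = (x : ℂ) ^ (-α) := by
      have : (c : ℂ) ^ (1 / 2 - α - 1) =
          (x : ℂ) ^ (1 / 2 - α - 1) * (x : ℂ) ^ (1 / 2 - α - 1) := by
        rw [hcx, sq, ← Complex.mul_cpow_ofReal_nonneg hx.le hx.le]
      rw [this, ← Complex.cpow_add _ _ hx0, ← Complex.cpow_add _ _ hx0]
      ring_nf
    rw [hM, ← hp, hcx]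
    field_simp
    ring

theorem measurable_r1 (α : ℂ) : Measurable (r1 α) := by
  unfold r1
  split_ifs <;> fun_prop

theorem norm_mulConv_le {h p : ℝ → ℂ} {k : ℝ} (hh : ∀ w : ℝ, 0 < w → ‖h w‖ ≤ w ^ (-k))
    (hp : MemEk k p) {x : ℝ} (hx : 0 < x) :
    ‖mulConv h p x‖ ≤ (∫ y in Ioi (0 : ℝ), ‖(y ^ (k - 1) : ℝ) • p y‖) * x ^ (-k) := by
  rw [← integral_mul_const]
  refine norm_integral_le_of_norm_le (Integrable.mul_const (Integrable.norm hp) _) ?_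
  filter_upwards [ae_restrict_mem measurableSet_Ioi] with y (hy : 0 < y)
  have := hh (x / y) (by positivity)
  rw [Real.div_rpow hx.le hy.le] at this
  rw [norm_mul, norm_mul, norm_div, norm_one, Complex.norm_real, Real.norm_of_nonneg hy.le,
    norm_smul, Real.norm_of_nonneg (by positivity)]
  calc 1 / y * ‖h (x / y)‖ * ‖p y‖ ≤ 1 / y * (x ^ (-k) / y ^ (-k)) * ‖p y‖ := by gcongr
    _ = y ^ (k - 1) * ‖p y‖ * x ^ (-k) := by
      rw [Real.rpow_sub_one hy.ne', Real.rpow_neg hy.le k]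
      field_simp

theorem integrableOn_mulConv_kernel {r f : ℝ → ℂ} {k C : ℝ} (hr : Measurable r)
    (hC : ∀ w : ℝ, 0 < w → w ≠ 1 → ‖r w‖ ≤ C * w ^ (-k)) (hf : MemEk k f) {x : ℝ} (hx : 0 < x) :
    IntegrableOn (fun y : ℝ => (1 / (y : ℂ)) * r (x / y) * f y) (Ioi 0) := by
  have hfm : AEStronglyMeasurable f (volume.restrict (Ioi 0)) :=
    (memEk_iff_mellinConvergent (s := (k : ℂ)).1 hf).aestronglyMeasurable
  have hrm : Measurable fun y : ℝ => (1 / (y : ℂ)) * r (x / y) := by fun_prop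
  refine Integrable.mono' (Integrable.const_mul (Integrable.norm hf) (C * x ^ (-k)))
    (hrm.aestronglyMeasurable.mul hfm) ?_
  have hae : ∀ᵐ y ∂(volume.restrict (Ioi (0 : ℝ))), y ≠ x :=
    ae_restrict_of_ae (Measure.ae_ne volume x)
  filter_upwards [ae_restrict_mem measurableSet_Ioi, hae] with y (hy : 0 < y) hyx
  have := hC (x / y) (by positivity) (fun h => hyx ((div_eq_one_iff_eq hy.ne').1 h).symm)
  rw [Real.div_rpow hx.le hy.le] at this
  rw [norm_mul, norm_mul, norm_div, norm_one, Complex.norm_real, Real.norm_of_nonneg hy.le,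
    norm_smul, Real.norm_of_nonneg (by positivity)]
  calc 1 / y * ‖r (x / y)‖ * ‖f y‖ ≤ 1 / y * (C * (x ^ (-k) / y ^ (-k))) * ‖f y‖ := by gcongr
    _ = C * x ^ (-k) * (y ^ (k - 1) * ‖f y‖) := by
      rw [Real.rpow_sub_one hy.ne', Real.rpow_neg hy.le k]
      field_simp

theorem rpow_le_one_add_sq {w a : ℝ} (hw : 0 < w) (h0 : 0 ≤ a) (h2 : a ≤ 2) :
    w ^ a ≤ 1 + w ^ 2 := by
  rcases le_total w 1 with h | h
  · have := Real.rpow_le_one hw.le h h0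
    nlinarith [sq_nonneg w]
  · have := Real.rpow_le_rpow_of_exponent_le h h2
    rw [Real.rpow_two] at this
    linarith

theorem rpow_le_one_add {w a : ℝ} (hw : 0 < w) (h0 : 0 ≤ a) (h1 : a ≤ 1) :
    w ^ a ≤ 1 + w := by
  rcases le_total w 1 with h | h
  · have := Real.rpow_le_one hw.le h h0
    linarith
  · have := Real.rpow_le_rpow_of_exponent_le h h1
    rw [Real.rpow_one] at this
    linarith

theorem norm_cpow_div_one_add_sq_le {a : ℂ} {k : ℝ} (h0 : 0 ≤ a.re + k) (h2 : a.re + k ≤ 2)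
    {w : ℝ} (hw : 0 < w) : ‖(w : ℂ) ^ a / (1 + (w : ℂ) ^ 2)‖ ≤ w ^ (-k) := by
  have e : (1 + (w : ℂ) ^ 2) = ((1 + w ^ 2 : ℝ) : ℂ) := by push_cast; rfl
  rw [norm_div, e, Complex.norm_real, Real.norm_of_nonneg (by positivity),
    Complex.norm_cpow_eq_rpow_re_of_pos hw, div_le_iff₀ (by positivity)]
  calc w ^ a.re = w ^ (-k) * w ^ (a.re + k) := by
        rw [← Real.rpow_add hw]; ring_nf
    _ ≤ _ := by gcongr; exact rpow_le_one_add_sq hw h0 h2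

theorem norm_one_div_one_add_le {k : ℝ} (h0 : 0 ≤ k) (h1 : k ≤ 1) {w : ℝ} (hw : 0 < w) :
    ‖1 / (1 + (w : ℂ))‖ ≤ w ^ (-k) := by
  have e : (1 + (w : ℂ)) = ((1 + w : ℝ) : ℂ) := by push_cast; rfl
  rw [norm_div, e, Complex.norm_real, Real.norm_of_nonneg (by positivity), norm_one,
    Real.rpow_neg hw.le, one_div]
  exact inv_anti₀ (by positivity) (rpow_le_one_add hw h0 h1)

theorem exists_norm_r1_le {α : ℂ} (hα1 : -(1/2) ≤ α.re) (hα2 : α.re < 1/2) {k : ℝ} (hk : 0 < k)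
    (hk1 : α.re < k) (hk2 : k < 1 - α.re) :
    ∃ C : ℝ, ∀ w : ℝ, 0 < w → w ≠ 1 → ‖r1 α w‖ ≤ C * w ^ (-k) := by
  have hp : MemEk k fun t : ℝ => (t : ℂ) ^ (-α) / (1 + (t : ℂ) ^ 2) :=
    (memEk_iff_mellinConvergent (s := (k : ℂ))).2 (hasMellin_cpow_div_one_add_sq
      (by norm_num; linarith) (by norm_num; linarith)).1
  have hh : ∀ w : ℝ, 0 < w → ‖(w : ℂ) ^ (α + 1) / (1 + (w : ℂ) ^ 2)‖ ≤ w ^ (-k) := fun w hw =>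
    norm_cpow_div_one_add_sq_le (by norm_num; linarith) (by norm_num; linarith) hw
  refine ⟨‖(2 / Real.pi : ℂ)‖ * ∫ y in Ioi (0 : ℝ),
    ‖(y ^ (k - 1) : ℝ) • ((y : ℂ) ^ (-α) / (1 + (y : ℂ) ^ 2))‖, fun w hw hw1 => ?_⟩
  rw [r1_eq_mulConv hα1 hα2 hw hw1, norm_mul, mul_assoc]
  exact mul_le_mul_of_nonneg_left (norm_mulConv_le hh hp hw) (norm_nonneg _)

theorem hasMellin_r1 {α z : ℂ} (hα1 : -(1/2) ≤ α.re) (hα2 : α.re < 1/2) (hz : 0 < z.re)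
    (hz1 : α.re < z.re) (hz2 : z.re < 1 - α.re) :
    Complex.sin (Real.pi * z) - Complex.sin (Real.pi * α) ≠ 0 ∧
    HasMellin (r1 α) z
      (Real.pi / (Complex.sin (Real.pi * z) - Complex.sin (Real.pi * α))) := by
  have hpi : (Real.pi : ℂ) ≠ 0 := by exact_mod_cast Real.pi_ne_zero
  have hh := hasMellin_cpow_div_one_add_sq (a := α + 1) (z := z)
    (by norm_num; linarith) (by norm_num; linarith)
  have hp := hasMellin_cpow_div_one_add_sq (a := -α) (z := z)
    (by norm_num; linarith) (by norm_num; linarith)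
  have hm := hasMellin_mulConv (h := fun t : ℝ => (t : ℂ) ^ (α + 1) / (1 + (t : ℂ) ^ 2))
    (by fun_prop) hh.1 hp.1
  have hm' := hasMellin_const_smul hm.1 (2 / Real.pi : ℂ)
  have hae : ∀ᵐ x : ℝ ∂(volume.restrict (Ioi (0 : ℝ))), (x : ℂ) ^ (z - 1) • ((2 / Real.pi : ℂ) •
      mulConv (fun t : ℝ => (t : ℂ) ^ (α + 1) / (1 + (t : ℂ) ^ 2))
        (fun t : ℝ => (t : ℂ) ^ (-α) / (1 + (t : ℂ) ^ 2)) x) = (x : ℂ) ^ (z - 1) • r1 α x := by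
    have hne : ∀ᵐ y ∂(volume.restrict (Ioi (0 : ℝ))), y ≠ 1 :=
      ae_restrict_of_ae (Measure.ae_ne volume 1)
    filter_upwards [ae_restrict_mem measurableSet_Ioi, hne] with x hx hx1
    rw [r1_eq_mulConv hα1 hα2 hx hx1, smul_eq_mul (2 / Real.pi : ℂ)]
  have s1 : Complex.sin (Real.pi * (z + (α + 1)) / 2) ≠ 0 := by
    have := sin_pi_mul_ne_zero_of_re_mem (s := (z + (α + 1)) / (2 : ℝ))
      (by rw [Complex.div_ofReal_re]; norm_num; linarith)
      (by rw [Complex.div_ofReal_re]; norm_num; linarith)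
      (fun h => by
        have := congrArg Complex.re h
        rw [Complex.div_ofReal_re] at this
        norm_num at this
        linarith)
    convert this using 2
    push_cast; ring
  have s2 : Complex.sin (Real.pi * (z + -α) / 2) ≠ 0 := by
    have := sin_pi_mul_ne_zero_of_re_mem (s := (z + -α) / (2 : ℝ))
      (by rw [Complex.div_ofReal_re]; norm_num; linarith)
      (by rw [Complex.div_ofReal_re]; norm_num; linarith)
      (fun h => by
        have := congrArg Complex.re h
        rw [Complex.div_ofReal_re] at this
        norm_num at this
        linarith)
    convert this using 2
    push_cast; ring
  have hs : Complex.sin (Real.pi * z) - Complex.sin (Real.pi * α) =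
      2 * Complex.sin (Real.pi * (z + -α) / 2) * Complex.sin (Real.pi * (z + (α + 1)) / 2) := by
    rw [Complex.sin_sub_sin]
    have : Complex.sin (Real.pi * (z + (α + 1)) / 2) =
        Complex.cos ((Real.pi * z + Real.pi * α) / 2) := by
      rw [← Complex.sin_add_pi_div_two]
      ring_nf
    rw [this]
    ring_nf
  refine ⟨by rw [hs]; exact mul_ne_zero (mul_ne_zero two_ne_zero s2) s1,
    Integrable.congr hm'.1 hae, ?_⟩
  rw [mellin, ← integral_congr_ae hae]
  refine hm'.2.trans ?_
  rw [hm.2, hh.2, hp.2, hs, smul_eq_mul]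
  field_simp

theorem mulConv_one_div_one_add (f : ℝ → ℂ) {x : ℝ} (hx : 0 < x) :
    EqOn (fun y : ℝ => (1 / (y : ℂ)) * (fun t : ℝ => 1 / (1 + (t : ℂ))) (x / y) * f y)
      (fun y : ℝ => f y / ((x : ℂ) + (y : ℂ))) (Ioi 0) := by
  intro y (hy : 0 < y)
  have hy0 : (y : ℂ) ≠ 0 := by exact_mod_cast hy.ne'
  have a1 : (y : ℂ) + x ≠ 0 := by exact_mod_cast (by positivity : y + x ≠ 0)
  have a2 : 1 + (x : ℂ) / y ≠ 0 := by exact_mod_cast (by positivity : 1 + x / y ≠ 0)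
  push_cast
  rw [add_comm (x : ℂ) y]
  field_simp

/-- Proposition 1, kernel `R₁`: for `-1/2 ≤ Re α ≤ 1/2`,
`max(0, Re α) < k < min(1, 1 - Re α)`, `λ = sin(πα)/π` and `g ∈ E_k`, a function
`f ∈ E_k` satisfies the Stieltjes equation a.e. iff `f = g + λ R₁ g` a.e. -/
theorem stmt6 (α : ℂ) (hα1 : -(1/2) ≤ α.re) (hα2 : α.re ≤ 1/2)
    (k : ℝ) (hk1 : max 0 α.re < k) (hk2 : k < min 1 (1 - α.re))
    (lam : ℂ) (hlam : lam = Complex.sin ((Real.pi : ℂ) * α) / (Real.pi : ℂ))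
    (g : ℝ → ℂ) (hg : MemEk k g) (f : ℝ → ℂ) (hf : MemEk k f) :
    ((∀ x : ℝ, 0 < x → IntegrableOn (fun y : ℝ => f y / ((x : ℂ) + (y : ℂ))) (Ioi 0)) ∧
      (∀ᵐ x ∂(volume.restrict (Ioi (0 : ℝ))),
        f x = g x + lam * ∫ y in Ioi (0 : ℝ), f y / ((x : ℂ) + (y : ℂ))))
    ↔
    ((∀ x : ℝ, 0 < x → IntegrableOn (fun y : ℝ => R1 α x y * g y) (Ioi 0)) ∧
      (∀ᵐ x ∂(volume.restrict (Ioi (0 : ℝ))),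
        f x = g x + lam * ∫ y in Ioi (0 : ℝ), R1 α x y * g y)) := by
  have hk0 : 0 < k := (le_max_left _ _).trans_lt hk1
  have hkα : α.re < k := (le_max_right _ _).trans_lt hk1
  have hk1' : k < 1 := hk2.trans_le (min_le_left _ _)
  have hkα' : k < 1 - α.re := hk2.trans_le (min_le_right _ _)
  have hα2' : α.re < 1 / 2 := by linarith
  have hpi : (Real.pi : ℂ) ≠ 0 := by exact_mod_cast Real.pi_ne_zero
  set s : ℝ → ℂ := fun t => 1 / (1 + (t : ℂ)) with hs
  have hsm : Measurable s := by fun_prop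
  obtain ⟨C, hC⟩ := exists_norm_r1_le hα1 hα2' hk0 hkα hkα'
  have hI1 : ∀ x : ℝ, 0 < x →
      IntegrableOn (fun y : ℝ => f y / ((x : ℂ) + (y : ℂ))) (Ioi 0) := fun x hx =>
    (integrableOn_mulConv_kernel (C := 1) hsm (fun w hw _ => by
      rw [one_mul]; exact norm_one_div_one_add_le hk0.le hk1'.le hw) hf hx).congr_fun
      (mulConv_one_div_one_add f hx) measurableSet_Ioi
  have hI2 : ∀ x : ℝ, 0 < x → IntegrableOn (fun y : ℝ => R1 α x y * g y) (Ioi 0) := fun x hx =>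
    integrableOn_mulConv_kernel (measurable_r1 α) hC hg hx
  have hfz : ∀ z : ℂ, z.re = k → MellinConvergent f z := fun z hz =>
    memEk_iff_mellinConvergent.1 (hz ▸ hf)
  have hgz : ∀ z : ℂ, z.re = k → MellinConvergent g z := fun z hz =>
    memEk_iff_mellinConvergent.1 (hz ▸ hg)
  have hequiv : ∀ {r p : ℝ → ℂ}, Measurable r → (∀ z : ℂ, z.re = k → MellinConvergent r z) →
      (∀ z : ℂ, z.re = k → MellinConvergent p z) →
      ((∀ᵐ x ∂(volume.restrict (Ioi (0 : ℝ))), f x = g x + lam * mulConv r p x) ↔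
        ∀ z : ℂ, z.re = k → mellin f z = mellin g z + lam * (mellin r z * mellin p z)) := by
    intro r p hrm hr hp
    have hE : ∀ z : ℂ, z.re = k → HasMellin (fun x => f x - g x - lam • mulConv r p x) z
        (mellin f z - mellin g z - lam • (mellin r z * mellin p z)) := by
      intro z hz
      have h1 := hasMellin_mulConv hrm (hr z hz) (hp z hz)
      have h2 := hasMellin_const_smul h1.1 lam
      have h3 := hasMellin_sub (hfz z hz) (hgz z hz)
      have h4 := hasMellin_sub h3.1 h2.1
      rwa [h3.2, h2.2, h1.2] at h4
    have hEk : MemEk k fun x => f x - g x - lam • mulConv r p x :=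
      (memEk_iff_mellinConvergent (s := (k : ℂ))).2 (hE k (Complex.ofReal_re k)).1
    have key := ae_eq_zero_iff_mellin_eq_zero hEk
    have e1 : ∀ x, f x = g x + lam * mulConv r p x ↔ f x - g x - lam • mulConv r p x = 0 :=
      fun x => by rw [smul_eq_mul, sub_sub, sub_eq_zero]
    simp_rw [e1, key]
    refine forall₂_congr fun z hz => ?_
    rw [(hE z hz).2, smul_eq_mul, sub_sub, sub_eq_zero]
  have hsz : ∀ z : ℂ, z.re = k →
      HasMellin s z (Real.pi / Complex.sin (Real.pi * z)) := fun z hz =>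
    hasMellin_one_div_one_add (hz ▸ hk0) (hz ▸ hk1')
  have hrz := fun (z : ℂ) (hz : z.re = k) =>
    hasMellin_r1 (α := α) (z := z) hα1 hα2' (hz ▸ hk0) (hz ▸ hkα) (hz ▸ hkα')
  have hS : (∀ᵐ x ∂(volume.restrict (Ioi (0 : ℝ))),
      f x = g x + lam * ∫ y in Ioi (0 : ℝ), f y / ((x : ℂ) + (y : ℂ))) ↔
      ∀ᵐ x ∂(volume.restrict (Ioi (0 : ℝ))), f x = g x + lam * mulConv s f x := by
    refine Filter.eventually_congr ?_
    filter_upwards [ae_restrict_mem measurableSet_Ioi] with x hx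
    rw [mulConv, setIntegral_congr_fun measurableSet_Ioi (mulConv_one_div_one_add f hx)]
  have hR : (∀ᵐ x ∂(volume.restrict (Ioi (0 : ℝ))),
      f x = g x + lam * ∫ y in Ioi (0 : ℝ), R1 α x y * g y) ↔
      ∀ᵐ x ∂(volume.restrict (Ioi (0 : ℝ))), f x = g x + lam * mulConv (r1 α) g x := Iff.rfl
  rw [and_iff_right hI1, and_iff_right hI2, hS, hR, hequiv hsm (fun z hz => (hsz z hz).1) hfz,
    hequiv (measurable_r1 α) (fun z hz => (hrz z hz).2.1) hgz]
  refine forall₂_congr fun z hz => ?_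
  obtain ⟨hne, hr⟩ := hrz z hz
  have hsin : Complex.sin (Real.pi * z) ≠ 0 :=
    sin_pi_mul_ne_zero_of_re_mem (hz ▸ hk0) (by linarith) (fun h => by rw [h, Complex.one_re] at hz; linarith)
  rw [(hsz z hz).2, hr.2, hlam]
  field_simp
  rw [← sub_eq_zero, ← sub_eq_zero (a := mellin f z * _)]
  ring_nf

end
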